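/- Let Ω ⊂ ℝ^s be a convex body containing the unisolvent set σ = {x_1,…,x_m}, let f ∈ C^{d,1}(Ω), and suppose the closed ball B_h(x̄) is contained in Ω; set K = B_h(x̄). Then for every x ∈ B_h(x̄) and every multi-index ν ∈ ℕ_0^s with |ν| ≤ d, the polynomial q(x) = Σ_{i=1}^m ℓ_i(x) R_T[f,x̄](x_i) satisfies |D^ν q(x)| ≤ k_d · M_{d,ν} · ‖f‖_{d,1}^K · h^{d−|ν|+1} · Λ_d(σ). -/

import Mathlib

open scoped BigOperators

noncomputable section

/-- Coordinate partial derivative along the `k`-th coordinate direction. -/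
def pd (s : ℕ) (k : Fin s) (g : EuclideanSpace ℝ (Fin s) → ℝ) :
    EuclideanSpace ℝ (Fin s) → ℝ :=
  fun x => fderiv ℝ g x (EuclideanSpace.single k 1)

/-- Multi-index partial derivative `D^ν`. -/
def Dmulti (s : ℕ) (ν : Fin s → ℕ) (g : EuclideanSpace ℝ (Fin s) → ℝ) :
    EuclideanSpace ℝ (Fin s) → ℝ :=
  (List.finRange s).foldr (fun k acc => (pd s k)^[ν k] acc) g

/-- The length `|ν|` of a multi-index. -/
def mdeg (s : ℕ) (ν : Fin s → ℕ) : ℕ := ∑ k, ν k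

/-- The factorial `ν!` of a multi-index. -/
def mfact (s : ℕ) (ν : Fin s → ℕ) : ℕ := ∏ k, Nat.factorial (ν k)

/-- The monomial power `z^ν`. -/
def mpow (s : ℕ) (z : EuclideanSpace ℝ (Fin s)) (ν : Fin s → ℕ) : ℝ :=
  ∏ k, (z k) ^ (ν k)

/-- The Taylor polynomial of order `d` of `f` centered at `xbar`, evaluated at `x`:
`T_d[f,x̄](x) = Σ_{|β|≤d} D^β f(x̄) (x−x̄)^β / β!`. -/
def taylorP (s d : ℕ) (f : EuclideanSpace ℝ (Fin s) → ℝ)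
    (xbar x : EuclideanSpace ℝ (Fin s)) : ℝ :=
  ∑ β : Fin s → Fin (d+1),
    if mdeg s (fun k => (β k : ℕ)) ≤ d then
      Dmulti s (fun k => (β k : ℕ)) f xbar * mpow s (x - xbar) (fun k => (β k : ℕ)) /
        (mfact s (fun k => (β k : ℕ)) : ℝ)
    else 0

/-- The Taylor remainder `R_T[f,x̄](x) = f(x) − T_d[f,x̄](x)`. -/
def taylorR (s d : ℕ) (f : EuclideanSpace ℝ (Fin s) → ℝ)
    (xbar x : EuclideanSpace ℝ (Fin s)) : ℝ :=
  f x - taylorP s d f xbar x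

/-- `f ∈ C^{d,1}(Ω)`: `f` is `C^d` on `Ω` and all its order-`d` partial derivatives are
Lipschitz continuous on `Ω`. -/
def Cd1 (s d : ℕ) (f : EuclideanSpace ℝ (Fin s) → ℝ)
    (Ω : Set (EuclideanSpace ℝ (Fin s))) : Prop :=
  ContDiffOn ℝ d f Ω ∧
    ∀ ν : Fin s → ℕ, mdeg s ν = d → ∃ L : NNReal, LipschitzOnWith L (Dmulti s ν f) Ω

/-- The seminorm `‖f‖_{d,1}^K`. -/
def semi (s d : ℕ) (f : EuclideanSpace ℝ (Fin s) → ℝ)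
    (K : Set (EuclideanSpace ℝ (Fin s))) : ℝ :=
  sSup { r : ℝ | ∃ (ν : Fin s → ℕ) (u v : EuclideanSpace ℝ (Fin s)),
    mdeg s ν = d ∧ u ∈ K ∧ v ∈ K ∧ u ≠ v ∧
    r = |Dmulti s ν f u - Dmulti s ν f v| / ‖u - v‖ }

/-- The constants `k_j = s^j/(j−1)!` for `j > 0`, `k_0 = 1`. -/
def kconst (s j : ℕ) : ℝ :=
  if j = 0 then 1 else (s : ℝ) ^ j / (Nat.factorial (j - 1) : ℝ)

/-- `M_{d,ν} = Π_{j=0}^{|ν|−1} (d−j)^2`. -/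
def Mconst (d : ℕ) {s : ℕ} (ν : Fin s → ℕ) : ℝ :=
  ∏ j ∈ Finset.range (mdeg s ν), ((d : ℝ) - (j : ℝ)) ^ 2

/-- The node set is unisolvent for polynomial interpolation of total degree at most `d`. -/
def Unisolvent (s d m : ℕ) (x : Fin m → EuclideanSpace ℝ (Fin s)) : Prop :=
  Function.Injective x ∧
    ∀ y : Fin m → ℝ, ∃! p : MvPolynomial (Fin s) ℝ,
      p.totalDegree ≤ d ∧ ∀ i, MvPolynomial.eval (fun k => x i k) p = y i

/-- `ℓ` is the family of fundamental Lagrange polynomials of the nodes `x`. -/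
def IsLagrangeBasis (s d m : ℕ) (x : Fin m → EuclideanSpace ℝ (Fin s))
    (ℓ : Fin m → MvPolynomial (Fin s) ℝ) : Prop :=
  (∀ i, (ℓ i).totalDegree ≤ d) ∧
    ∀ i j, MvPolynomial.eval (fun k => x j k) (ℓ i) = if i = j then (1 : ℝ) else 0

/-- The interpolating polynomial `p[y,σ] = Σ_i y_i ℓ_i`, as a function. -/
def interp (s m : ℕ) (ℓ : Fin m → MvPolynomial (Fin s) ℝ) (y : Fin m → ℝ) :
    EuclideanSpace ℝ (Fin s) → ℝ :=
  fun x => ∑ i, y i * MvPolynomial.eval (fun k => x k) (ℓ i)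

/-- The Lebesgue constant `Λ_d(σ) = max_{x ∈ Ω} Σ_i |ℓ_i(x)|`. -/
def lebesgue (s m : ℕ) (ℓ : Fin m → MvPolynomial (Fin s) ℝ)
    (Ω : Set (EuclideanSpace ℝ (Fin s))) : ℝ :=
  sSup ((fun x : EuclideanSpace ℝ (Fin s) =>
    ∑ i, |MvPolynomial.eval (fun k => x k) (ℓ i)|) '' Ω)

/-- Maximum absolute column sum (operator `1`-)norm of a square matrix. -/
def onenorm (m : ℕ) (M : Matrix (Fin m) (Fin m) ℝ) : ℝ := ⨆ j, ∑ i, |M i j|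

section Bernstein
open Finset

/-- Riesz nodes as roots of unity. -/
def rz (n : ℕ) : ℂ := Complex.exp (2 * Real.pi * Complex.I / ((4 * n : ℕ) : ℂ))

def rth (n k : ℕ) : ℝ := (2 * k + 1) * (2 * Real.pi / (4 * n : ℕ))

def ra (n k : ℕ) : ℝ := 1 / (2 * n * (1 - Real.cos (rth n k)))

def rS (n : ℕ) (j : ℤ) : ℂ :=
  ∑ k ∈ range (2 * n), (-1 : ℂ) ^ k * (ra n k : ℂ) * (rz n) ^ (j * (2 * k + 1))

lemma rz_prim (n : ℕ) (hn : 1 ≤ n) : IsPrimitiveRoot (rz n) (4 * n) :=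
  Complex.isPrimitiveRoot_exp _ (by omega)

lemma rz_ne (n : ℕ) : rz n ≠ 0 := Complex.exp_ne_zero _

lemma rz_pow_n (n : ℕ) (hn : 1 ≤ n) : rz n ^ n = Complex.I := by
  have hn0 : (n : ℂ) ≠ 0 := by exact_mod_cast (by omega : n ≠ 0)
  rw [rz, ← Complex.exp_nat_mul]
  refine Eq.trans ?_ Complex.exp_pi_div_two_mul_I
  congr 1
  push_cast
  field_simp
  ring

lemma rz_pow_odd (n k : ℕ) : rz n ^ (2 * k + 1) = Complex.exp (rth n k * Complex.I) := by
  rw [rz, ← Complex.exp_nat_mul, rth]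
  congr 1
  push_cast
  ring

lemma rth_pos (n k : ℕ) (hn : 1 ≤ n) : 0 < rth n k := by
  have : (0 : ℝ) < n := by exact_mod_cast hn
  have := Real.pi_pos
  unfold rth; push_cast; positivity

lemma rth_lt (n k : ℕ) (hn : 1 ≤ n) (hk : k < 2 * n) : rth n k < 2 * Real.pi := by
  have h0 : (0 : ℝ) < n := by exact_mod_cast hn
  have hp := Real.pi_pos
  have : (2 * (k : ℝ) + 1) < 4 * n := by exact_mod_cast (by omega : 2 * k + 1 < 4 * n)
  unfold rth; push_cast
  rw [← mul_div_assoc, div_lt_iff₀ (by positivity)]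
  nlinarith

lemma cos_rth_lt (n k : ℕ) (hn : 1 ≤ n) (hk : k < 2 * n) : Real.cos (rth n k) < 1 := by
  refine lt_of_le_of_ne (Real.cos_le_one _) fun h => ?_
  have := (Real.cos_eq_one_iff_of_lt_of_lt (by linarith [rth_pos n k hn, Real.pi_pos])
    (rth_lt n k hn hk)).1 h
  linarith [rth_pos n k hn]

lemma ra_nonneg (n k : ℕ) (hn : 1 ≤ n) (hk : k < 2 * n) : 0 ≤ ra n k := by
  have := cos_rth_lt n k hn hk
  have h2 : 0 < 1 - Real.cos (rth n k) := by linarith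
  unfold ra; positivity

lemma ra_mul (n k : ℕ) (hn : 1 ≤ n) (hk : k < 2 * n) :
    (ra n k : ℂ) * (rz n ^ (2 * k + 1) - 2 + (rz n ^ (2 * k + 1))⁻¹) = -1 / n := by
  have hn0 : (n : ℂ) ≠ 0 := by exact_mod_cast (by omega : n ≠ 0)
  have := cos_rth_lt n k hn hk
  have h2 : (1 - Real.cos (rth n k) : ℂ) ≠ 0 := by
    have : (1 - Real.cos (rth n k)) ≠ 0 := by linarith
    exact_mod_cast this
  have h3 : rz n ^ (2 * k + 1) + (rz n ^ (2 * k + 1))⁻¹ = 2 * (Real.cos (rth n k) : ℂ) := by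
    rw [rz_pow_odd, ← Complex.exp_neg, Complex.ofReal_cos, Complex.two_cos]
    congr 2
    ring
  have h4 : rz n ^ (2 * k + 1) - 2 + (rz n ^ (2 * k + 1))⁻¹
      = -(2 * (1 - (Real.cos (rth n k) : ℂ))) := by linear_combination h3
  rw [h4, ra]
  push_cast at h2 ⊢
  field_simp

lemma rS_diff (n : ℕ) (hn : 1 ≤ n) (j : ℤ) :
    rS n (j + 1) - 2 * rS n j + rS n (j - 1) =
      -1 / n * ∑ k ∈ range (2 * n), (-1 : ℂ) ^ k * (rz n) ^ (j * (2 * k + 1)) := by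
  unfold rS
  rw [mul_sum, mul_sum, ← sum_sub_distrib, ← sum_add_distrib]
  refine sum_congr rfl fun k hk => ?_
  rw [← ra_mul n k hn (mem_range.1 hk)]
  have e1 : rz n ^ ((j + 1) * (2 * (k : ℤ) + 1)) =
      rz n ^ (j * (2 * (k : ℤ) + 1)) * rz n ^ (2 * k + 1) := by
    rw [add_mul, one_mul, zpow_add₀ (rz_ne n)]
    congr 1
  have e2 : rz n ^ ((j - 1) * (2 * (k : ℤ) + 1)) =
      rz n ^ (j * (2 * (k : ℤ) + 1)) * (rz n ^ (2 * k + 1))⁻¹ := by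
    rw [sub_mul, one_mul, zpow_sub₀ (rz_ne n), div_eq_mul_inv]
    congr 1
  rw [e1, e2]
  ring

lemma geom_zero (n : ℕ) (hn : 1 ≤ n) (j : ℕ) (hj : j < n) :
    ∑ k ∈ range (2 * n), (-1 : ℂ) ^ k * (rz n) ^ ((j : ℤ) * (2 * k + 1)) = 0 := by
  have hpr := rz_prim n hn
  have hq : -(rz n ^ (2 * j)) ≠ 1 := by
    intro h
    have h1 : rz n ^ (2 * j) = rz n ^ (2 * n) := by
      rw [mul_comm 2 n, pow_mul (rz n) n, rz_pow_n n hn, Complex.I_sq, ← h, neg_neg]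
    have := hpr.pow_inj (by omega) (by omega) h1
    omega
  have hq2 : (-(rz n ^ (2 * j))) ^ (2 * n) = 1 := by
    rw [Even.neg_pow (by simp), ← pow_mul, show 2 * j * (2 * n) = 4 * n * j by ring, pow_mul,
      hpr.pow_eq_one, one_pow]
  have : ∀ k ∈ range (2 * n), (-1 : ℂ) ^ k * (rz n) ^ ((j : ℤ) * (2 * k + 1)) =
      rz n ^ j * (-(rz n ^ (2 * j))) ^ k := by
    intro k _
    have : rz n ^ ((j : ℤ) * (2 * k + 1)) = rz n ^ (j * (2 * k + 1)) := by
      rw [← zpow_natCast]; push_cast; rfl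
    rw [this, neg_pow (rz n ^ (2 * j)), ← pow_mul]
    ring
  rw [sum_congr rfl this, ← mul_sum, geom_sum_eq hq, hq2]
  simp

lemma rz_n_odd (n : ℕ) (hn : 1 ≤ n) (k : ℕ) :
    rz n ^ ((n : ℤ) * (2 * k + 1)) = Complex.I * (-1) ^ k := by
  have : rz n ^ ((n : ℤ) * (2 * k + 1)) = rz n ^ (n * (2 * k + 1)) := by
    rw [← zpow_natCast]; push_cast; rfl
  rw [this, pow_mul, rz_pow_n n hn, pow_succ, pow_mul, Complex.I_sq]
  ring

lemma geom_n (n : ℕ) (hn : 1 ≤ n) :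
    ∑ k ∈ range (2 * n), (-1 : ℂ) ^ k * (rz n) ^ ((n : ℤ) * (2 * k + 1)) = 2 * n * Complex.I := by
  have : ∀ k ∈ range (2 * n), (-1 : ℂ) ^ k * (rz n) ^ ((n : ℤ) * (2 * k + 1)) = Complex.I := by
    intro k _
    rw [rz_n_odd n hn, mul_left_comm, ← mul_pow]; simp
  rw [sum_congr rfl this]; simp

lemma rS_add (n : ℕ) (hn : 1 ≤ n) (j : ℤ) : rS n (j + 2 * n) = - rS n j := by
  unfold rS
  rw [← sum_neg_distrib]
  refine sum_congr rfl fun k _ => ?_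
  have : rz n ^ ((j + 2 * n) * (2 * (k : ℤ) + 1)) = - rz n ^ (j * (2 * (k : ℤ) + 1)) := by
    rw [show (j + 2 * n) * (2 * (k : ℤ) + 1) = j * (2 * (k : ℤ) + 1) + n * (2 * k + 1) +
      n * (2 * k + 1) by ring, zpow_add₀ (rz_ne n), zpow_add₀ (rz_ne n), rz_n_odd n hn]
    have h1 : ((-1 : ℂ) ^ k) * (-1) ^ k = 1 := by rw [← mul_pow]; simp
    linear_combination (rz n ^ (j * (2 * (k : ℤ) + 1))) *
      ((-1 : ℂ) ^ k * (-1) ^ k * Complex.I_mul_I - h1)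
  rw [this]; ring

lemma rS_neg (n : ℕ) (hn : 1 ≤ n) (j : ℤ) : rS n (-j) = - rS n j := by
  have hpr := rz_prim n hn
  unfold rS
  rw [← sum_range_reflect, ← sum_neg_distrib]
  refine sum_congr rfl fun k hk => ?_
  have hk := mem_range.1 hk
  have hc : ((2 * n - 1 - k : ℕ) : ℤ) = 2 * n - 1 - k := by omega
  have h1 : ra n (2 * n - 1 - k) = ra n k := by
    have : rth n (2 * n - 1 - k) = 2 * Real.pi - rth n k := by
      have h0 : (n : ℝ) ≠ 0 := by exact_mod_cast (by omega : n ≠ 0)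
      have hcr : ((2 * n - 1 - k : ℕ) : ℝ) = 2 * n - 1 - k := by exact_mod_cast hc
      unfold rth; rw [hcr]; push_cast; field_simp; ring
    rw [ra, ra, this, Real.cos_two_pi_sub]
  have h2 : (-1 : ℂ) ^ (2 * n - 1 - k) = - (-1) ^ k := by
    have e : (-1 : ℂ) ^ (2 * n - 1 - k) * ((-1) ^ k * (-1)) = 1 := by
      rw [← pow_succ, ← pow_add, show 2 * n - 1 - k + (k + 1) = 2 * n by omega, pow_mul]; simp
    have e2 : ((-1 : ℂ) ^ k) * (-1) ^ k = 1 := by rw [← mul_pow]; simp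
    linear_combination (-(-1 : ℂ) ^ k) * e - (-1 : ℂ) ^ (2 * n - 1 - k) * e2
  have h3 : rz n ^ (-j * (2 * ((2 * n - 1 - k : ℕ) : ℤ) + 1)) = rz n ^ (j * (2 * (k : ℤ) + 1)) := by
    rw [hc, show -j * (2 * (2 * (n : ℤ) - 1 - k) + 1) = j * (2 * k + 1) + ((4 * n : ℕ) : ℤ) * (-j) by
      push_cast; ring, zpow_add₀ (rz_ne n), zpow_mul (rz n) ((4 * n : ℕ) : ℤ), zpow_natCast,
      hpr.pow_eq_one]
    simp
  rw [h1, h2, h3]; ring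

lemma rS_nat (n : ℕ) (hn : 1 ≤ n) (j : ℕ) (hj : j + 1 ≤ n) :
    rS n j = j * rS n 1 ∧ rS n (j + 1 : ℕ) = (j + 1 : ℕ) * rS n 1 := by
  have h0 : rS n 0 = 0 := by
    have := rS_neg n hn 0
    rw [neg_zero] at this
    linear_combination this / 2
  induction j with
  | zero => simp [h0]
  | succ j ih =>
    obtain ⟨h1, h2⟩ := ih (by omega)
    refine ⟨h2, ?_⟩
    have := rS_diff n hn (j + 1 : ℕ)
    rw [geom_zero n hn (j + 1) (by omega)] at this
    have e1 : ((j + 1 : ℕ) : ℤ) + 1 = ((j + 1 + 1 : ℕ) : ℤ) := by push_cast; ring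
    have e2 : ((j + 1 : ℕ) : ℤ) - 1 = (j : ℤ) := by push_cast; ring
    rw [e1, e2, h1, h2] at this
    push_cast at this ⊢
    linear_combination this

lemma rS_one (n : ℕ) (hn : 1 ≤ n) : rS n 1 = Complex.I := by
  have hn0 : (n : ℂ) ≠ 0 := by exact_mod_cast (by omega : n ≠ 0)
  have h := rS_diff n hn n
  rw [geom_n n hn] at h
  have e : rS n (n + 1) = rS n (n - 1) := by
    rw [show (n : ℤ) + 1 = (-((n : ℤ) - 1)) + 2 * n by ring, rS_add n hn, rS_neg n hn, neg_neg]
  obtain ⟨p, rfl⟩ : ∃ p, n = p + 1 := ⟨n - 1, by omega⟩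
  obtain ⟨h1, h2⟩ := rS_nat (p + 1) hn p le_rfl
  rw [e, h2, show ((p + 1 : ℕ) : ℤ) - 1 = (p : ℤ) by push_cast; ring, h1] at h
  field_simp at h
  push_cast at h
  linear_combination -h / 2

lemma rS_eq (n : ℕ) (hn : 1 ≤ n) (j : ℕ) (hj : j ≤ n) : rS n j = j * Complex.I := by
  rcases Nat.eq_zero_or_pos j with rfl | h
  · have := (rS_nat n hn 0 (by omega)).1
    simpa using this
  · obtain ⟨p, rfl⟩ : ∃ p, j = p + 1 := ⟨j - 1, by omega⟩
    rw [(rS_nat n hn p hj).2, rS_one n hn]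

lemma rS_eq_int (n : ℕ) (hn : 1 ≤ n) (j : ℤ) (h1 : -(n : ℤ) ≤ j) (h2 : j ≤ n) :
    rS n j = j * Complex.I := by
  rcases le_total 0 j with h | h
  · lift j to ℕ using h
    rw [rS_eq n hn j (by omega)]
    push_cast
    rfl
  · obtain ⟨i, rfl⟩ : ∃ i : ℤ, j = -i := ⟨-j, by ring⟩
    lift i to ℕ using (by omega)
    rw [rS_neg n hn, rS_eq n hn i (by omega)]
    push_cast
    ring

lemma ra_sum (n : ℕ) (hn : 1 ≤ n) : ∑ k ∈ range (2 * n), ra n k = n := by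
  have h := rS_eq n hn n le_rfl
  unfold rS at h
  have : ∀ k ∈ range (2 * n), (-1 : ℂ) ^ k * (ra n k : ℂ) * (rz n) ^ ((n : ℤ) * (2 * k + 1)) =
      (ra n k : ℂ) * Complex.I := by
    intro k _
    have e2 : ((-1 : ℂ) ^ k) * (-1) ^ k = 1 := by rw [← mul_pow]; simp
    rw [rz_n_odd n hn]
    linear_combination (ra n k : ℂ) * Complex.I * e2
  rw [sum_congr rfl this, ← sum_mul] at h
  have := mul_right_cancel₀ Complex.I_ne_zero h
  exact_mod_cast this

/-- Trigonometric polynomials of degree at most `n`. -/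
def Trig (n : ℕ) (F : ℝ → ℝ) : Prop :=
  ∃ P : Polynomial ℂ, P.natDegree ≤ 2 * n ∧
    ∀ t : ℝ, (F t : ℂ) * Complex.exp (t * Complex.I) ^ n = P.eval (Complex.exp (t * Complex.I))

lemma Trig.expand {n : ℕ} {F : ℝ → ℝ} (h : Trig n F) : ∃ c : ℕ → ℂ,
    ∀ t : ℝ, (F t : ℂ) = ∑ j ∈ range (2 * n + 1),
      c j * Complex.exp (((j : ℂ) - n) * Complex.I * t) := by
  obtain ⟨P, hP, h⟩ := h
  refine ⟨P.coeff, fun t => ?_⟩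
  have h1 := h t
  rw [Polynomial.eval_eq_sum_range' (Nat.lt_succ_of_le hP)] at h1
  have hne : Complex.exp (t * Complex.I) ^ n ≠ 0 := pow_ne_zero _ (Complex.exp_ne_zero _)
  refine mul_right_cancel₀ hne ?_
  rw [h1, sum_mul]
  refine sum_congr rfl fun j _ => ?_
  rw [mul_assoc, ← Complex.exp_nat_mul, ← Complex.exp_nat_mul, ← Complex.exp_add]
  congr 2
  ring

theorem Trig.bernstein {n : ℕ} (hn : 1 ≤ n) {F : ℝ → ℝ} (h : Trig n F) {M F' : ℝ}
    (hM : ∀ t, |F t| ≤ M) (hF : HasDerivAt F F' 0) : |F'| ≤ n * M := by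
  obtain ⟨c, hc⟩ := h.expand
  have hd : (F' : ℂ) = ∑ j ∈ range (2 * n + 1), c j * (((j : ℂ) - n) * Complex.I) := by
    have h1 : HasDerivAt (fun t => (F t : ℂ)) (F' : ℂ) 0 := hF.ofReal_comp
    have h2 : HasDerivAt (fun t : ℝ => (F t : ℂ))
        (∑ j ∈ range (2 * n + 1), c j * (((j : ℂ) - n) * Complex.I)) 0 := by
      have : (fun t : ℝ => (F t : ℂ)) = fun t : ℝ => ∑ j ∈ range (2 * n + 1),
        c j * Complex.exp (((j : ℂ) - n) * Complex.I * t) := funext hc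
      rw [this]
      refine HasDerivAt.fun_sum fun j _ => ?_
      refine HasDerivAt.const_mul _ ?_
      have h3 : HasDerivAt (fun t : ℝ => (t : ℂ)) 1 0 := Complex.ofRealCLM.hasDerivAt
      have h4 := (h3.const_mul (((j : ℂ) - n) * Complex.I)).cexp
      simpa using h4
    exact h1.unique h2
  have hk : (F' : ℂ) = ∑ k ∈ range (2 * n), (-1 : ℂ) ^ k * (ra n k : ℂ) * (F (rth n k) : ℂ) := by
    rw [hd]
    have : ∀ k ∈ range (2 * n), (-1 : ℂ) ^ k * (ra n k : ℂ) * (F (rth n k) : ℂ) =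
        ∑ j ∈ range (2 * n + 1), c j * ((-1 : ℂ) ^ k * (ra n k : ℂ) *
          rz n ^ (((j : ℤ) - n) * (2 * k + 1))) := by
      intro k _
      rw [hc, mul_sum]
      refine sum_congr rfl fun j _ => ?_
      have : Complex.exp (((j : ℂ) - n) * Complex.I * (rth n k : ℝ)) =
          rz n ^ (((j : ℤ) - n) * (2 * k + 1)) := by
        have e : rz n ^ (((j : ℤ) - n) * (2 * k + 1)) = (rz n ^ (2 * k + 1)) ^ ((j : ℤ) - n) := by
          rw [mul_comm, zpow_mul]; congr 1
        rw [e, rz_pow_odd, ← Complex.exp_int_mul]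
        congr 1
        push_cast
        ring
      rw [this]; ring
    rw [sum_congr rfl this, sum_comm]
    refine sum_congr rfl fun j hj => ?_
    have hj := mem_range.1 hj
    rw [← mul_sum]
    congr 1
    have := rS_eq_int n hn ((j : ℤ) - n) (by omega) (by omega)
    unfold rS at this
    rw [this]
    push_cast
    ring
  have hn1 : |F'| = ‖(F' : ℂ)‖ := by simp
  rw [hn1, hk, ← ra_sum n hn, sum_mul]
  refine (norm_sum_le _ _).trans (sum_le_sum fun k hk => ?_)
  have := ra_nonneg n k hn (mem_range.1 hk)
  rw [norm_mul, norm_mul, norm_pow, norm_neg, norm_one, one_pow, one_mul, Complex.norm_real,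
    Complex.norm_real, Real.norm_of_nonneg this]
  exact mul_le_mul_of_nonneg_left (hM _) this

lemma Trig.mono {n n' : ℕ} {F : ℝ → ℝ} (h : Trig n F) (hn : n ≤ n') : Trig n' F := by
  obtain ⟨P, hP, h⟩ := h
  refine ⟨P * Polynomial.X ^ (n' - n), ?_, fun t => ?_⟩
  · refine Polynomial.natDegree_mul_le.trans ?_
    rw [Polynomial.natDegree_X_pow]
    omega
  · rw [Polynomial.eval_mul, ← h t, Polynomial.eval_pow, Polynomial.eval_X, mul_assoc, ← pow_add]
    congr 2
    omega

lemma Trig.add {n : ℕ} {F G : ℝ → ℝ} (h : Trig n F) (h' : Trig n G) :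
    Trig n (fun t => F t + G t) := by
  obtain ⟨P, hP, h⟩ := h
  obtain ⟨Q, hQ, h'⟩ := h'
  refine ⟨P + Q, (Polynomial.natDegree_add_le _ _).trans (max_le hP hQ), fun t => ?_⟩
  rw [Polynomial.eval_add, ← h t, ← h' t]
  push_cast
  ring

lemma Trig.mul {n n' : ℕ} {F G : ℝ → ℝ} (h : Trig n F) (h' : Trig n' G) :
    Trig (n + n') (fun t => F t * G t) := by
  obtain ⟨P, hP, h⟩ := h
  obtain ⟨Q, hQ, h'⟩ := h'
  refine ⟨P * Q, Polynomial.natDegree_mul_le.trans (by omega), fun t => ?_⟩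
  rw [Polynomial.eval_mul, ← h t, ← h' t]
  push_cast
  ring

lemma Trig.const (c : ℝ) : Trig 0 (fun _ => c) :=
  ⟨Polynomial.C (c : ℂ), by simp, fun t => by simp⟩

lemma Trig.sin : Trig 1 Real.sin := by
  refine ⟨Polynomial.C (-Complex.I / 2) * Polynomial.X ^ 2 + Polynomial.C (Complex.I / 2),
    by compute_degree, fun t => ?_⟩
  have h : Complex.exp (-(t : ℂ) * Complex.I) * Complex.exp (t * Complex.I) = 1 := by
    rw [← Complex.exp_add]; simp
  simp only [Polynomial.eval_add, Polynomial.eval_mul, Polynomial.eval_C, Polynomial.eval_pow,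
    Polynomial.eval_X, pow_one, Complex.ofReal_sin, Complex.sin]
  linear_combination Complex.I / 2 * h

lemma Trig.cos : Trig 1 Real.cos := by
  refine ⟨Polynomial.C (1 / 2) * Polynomial.X ^ 2 + Polynomial.C (1 / 2),
    by compute_degree, fun t => ?_⟩
  have h : Complex.exp (-(t : ℂ) * Complex.I) * Complex.exp (t * Complex.I) = 1 := by
    rw [← Complex.exp_add]; simp
  simp only [Polynomial.eval_add, Polynomial.eval_mul, Polynomial.eval_C, Polynomial.eval_pow,
    Polynomial.eval_X, pow_one, Complex.ofReal_cos, Complex.cos]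
  linear_combination 1 / 2 * h

lemma Trig.pow {n : ℕ} {F : ℝ → ℝ} (h : Trig n F) (k : ℕ) : Trig (k * n) (fun t => F t ^ k) := by
  induction k with
  | zero => simpa using Trig.const 1
  | succ k ih =>
    have := ih.mul h
    simpa [pow_succ, Nat.succ_mul] using this

lemma Trig.sum {ι : Type*} (S : Finset ι) {n : ℕ} {F : ι → ℝ → ℝ} (h : ∀ i ∈ S, Trig n (F i)) :
    Trig n (fun t => ∑ i ∈ S, F i t) := by
  classical
  induction S using Finset.induction_on with
  | empty => simpa using (Trig.const 0).mono (Nat.zero_le n)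
  | insert a S ha ih =>
    simp only [sum_insert ha]
    exact (h a (by simp)).add (ih fun i hi => h i (by simp [hi]))

lemma Trig.prod {ι : Type*} (S : Finset ι) {n : ι → ℕ} {F : ι → ℝ → ℝ}
    (h : ∀ i ∈ S, Trig (n i) (F i)) :
    Trig (∑ i ∈ S, n i) (fun t => ∏ i ∈ S, F i t) := by
  classical
  induction S using Finset.induction_on with
  | empty => simpa using (Trig.const 1)
  | insert a S ha ih =>
    simp only [sum_insert ha, prod_insert ha]
    exact (h a (by simp)).mul (ih fun i hi => h i (by simp [hi]))

lemma Trig.mvpoly {s n : ℕ} (p : MvPolynomial (Fin s) ℝ) (hp : p.totalDegree ≤ n)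
    (E : Fin s → ℝ → ℝ) (hE : ∀ k, Trig 1 (E k)) :
    Trig n (fun t => MvPolynomial.eval (fun k => E k t) p) := by
  simp only [MvPolynomial.eval_eq']
  refine Trig.sum _ fun b hb => ?_
  have h1 : Trig (∑ k, b k * 1) (fun t => ∏ k, E k t ^ b k) :=
    Trig.prod _ fun k _ => (hE k).pow (b k)
  have h2 := (Trig.const (p.coeff b)).mul h1
  refine h2.mono ?_
  have := MvPolynomial.le_totalDegree hb
  rw [Finsupp.sum_fintype _ _ (by simp)] at this
  simp only [mul_one, zero_add]
  omega

end Bernstein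

section Markov
open Finset

lemma totalDegree_pderiv_le' {s : ℕ} (k : Fin s) (p : MvPolynomial (Fin s) ℝ) {n : ℕ}
    (hp : p.totalDegree ≤ n + 1) : (MvPolynomial.pderiv k p).totalDegree ≤ n := by
  rw [p.as_sum, map_sum]
  refine MvPolynomial.totalDegree_finsetSum_le fun b hb => ?_
  rw [MvPolynomial.pderiv_monomial]
  by_cases h0 : b k = 0
  · simp [h0]
  · refine (MvPolynomial.totalDegree_monomial_le _ _).trans ?_
    have h1 := MvPolynomial.le_totalDegree hb
    rw [Finsupp.sum_fintype _ _ (by simp)] at h1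
    rw [Finsupp.sum_fintype _ _ (by simp)]
    have h2 : ∑ i, (b - Finsupp.single k 1 : Fin s →₀ ℕ) i + 1 = ∑ i, b i := by
      rw [← add_sum_erase _ _ (mem_univ k), ← add_sum_erase univ (fun i => b i) (mem_univ k)]
      have : ∑ i ∈ univ.erase k, (b - Finsupp.single k 1 : Fin s →₀ ℕ) i = ∑ i ∈ univ.erase k, b i := by
        refine sum_congr rfl fun i hi => ?_
        have hne : k ≠ i := (ne_of_mem_erase hi).symm
        simp [Finsupp.single_apply, hne]
      rw [this]
      simp
      omega
    simp only [id]
    omega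

lemma hasFDerivAt_eval {s : ℕ} (p : MvPolynomial (Fin s) ℝ) (z : EuclideanSpace ℝ (Fin s)) :
    HasFDerivAt (fun z : EuclideanSpace ℝ (Fin s) => MvPolynomial.eval (fun k => z k) p)
      (∑ k, MvPolynomial.eval (fun k => z k) (MvPolynomial.pderiv k p) •
        (EuclideanSpace.proj k : EuclideanSpace ℝ (Fin s) →L[ℝ] ℝ)) z := by
  induction p using MvPolynomial.induction_on with
  | C a => simpa using hasFDerivAt_const a z
  | add p q hp hq =>
    have := hp.add hq
    simp only [map_add, add_smul, sum_add_distrib]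
    exact this
  | mul_X p i hp =>
    have h1 : HasFDerivAt (fun z : EuclideanSpace ℝ (Fin s) => z i)
      (EuclideanSpace.proj i : EuclideanSpace ℝ (Fin s) →L[ℝ] ℝ) z :=
      (EuclideanSpace.proj i : EuclideanSpace ℝ (Fin s) →L[ℝ] ℝ).hasFDerivAt
    have := hp.mul h1
    simp only [map_mul, MvPolynomial.eval_X]
    refine this.congr_fderiv ?_
    ext v
    simp [MvPolynomial.pderiv_X, Pi.single_apply, Finset.sum_add_distrib, add_mul, mul_sum,
      apply_ite]
    exact sum_congr rfl fun j _ => by ring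

lemma pd_eval {s : ℕ} (k : Fin s) (p : MvPolynomial (Fin s) ℝ) :
    pd s k (fun z => MvPolynomial.eval (fun k => z k) p) =
      fun z => MvPolynomial.eval (fun k => z k) (MvPolynomial.pderiv k p) := by
  funext z
  unfold pd
  rw [(hasFDerivAt_eval p z).fderiv]
  simp [Pi.single_apply]

/-- Bernstein inequality on the ball. -/
lemma bernstein_ball {s n : ℕ} (hn : 1 ≤ n) (p : MvPolynomial (Fin s) ℝ) (hp : p.totalDegree ≤ n)
    (c : EuclideanSpace ℝ (Fin s)) (h M : ℝ) (hh : 0 ≤ h)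
    (hM : ∀ z ∈ Metric.closedBall c h, |MvPolynomial.eval (fun k => z k) p| ≤ M)
    (x : EuclideanSpace ℝ (Fin s)) (hx : x ∈ Metric.closedBall c h) (k : Fin s) :
    Real.sqrt (h ^ 2 - ‖x - c‖ ^ 2) *
      |MvPolynomial.eval (fun k => x k) (MvPolynomial.pderiv k p)| ≤ n * M := by
  have hxn : ‖x - c‖ ≤ h := by simpa [dist_eq_norm] using hx
  set r := Real.sqrt (h ^ 2 - ‖x - c‖ ^ 2) with hr
  have hr2 : r ^ 2 = h ^ 2 - ‖x - c‖ ^ 2 := Real.sq_sqrt (by nlinarith [norm_nonneg (x - c)])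
  set u : EuclideanSpace ℝ (Fin s) := EuclideanSpace.single k 1 with hu
  have hun : ‖u‖ = 1 := by simp [hu]
  let E : ℝ → EuclideanSpace ℝ (Fin s) :=
    fun t => c + (Real.cos t) • (x - c) + (Real.sin t) • (r • u)
  have hE : ∀ t, E t ∈ Metric.closedBall c h := by
    intro t
    rw [Metric.mem_closedBall, dist_eq_norm]
    have e : E t - c = (Real.cos t) • (x - c) + (Real.sin t * r) • u := by
      simp only [E, smul_smul]; abel
    rw [e]
    refine abs_le_of_sq_le_sq' ?_ hh |>.2
    rw [norm_add_sq_real, norm_smul, norm_smul, hun, inner_smul_left, inner_smul_right]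
    have hi := abs_real_inner_le_norm (x - c) u
    rw [hun, mul_one] at hi
    have hi2 := sq_le_sq' (by linarith [abs_le.1 hi]) (abs_le.1 hi).2
    simp only [mul_one, mul_pow, Real.norm_eq_abs, sq_abs, conj_trivial]
    have hcs := Real.sin_sq_add_cos_sq t
    set i0 := inner ℝ (x - c) u
    set S := Real.sin t
    set C := Real.cos t
    have : 0 ≤ S ^ 2 * (‖x - c‖ ^ 2 - i0 ^ 2) := mul_nonneg (sq_nonneg _) (by linarith)
    have h2 := sq_nonneg (r * C - i0 * S)
    have h3 : h ^ 2 = r ^ 2 * (S ^ 2 + C ^ 2) + ‖x - c‖ ^ 2 * (S ^ 2 + C ^ 2) := by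
      rw [hcs, hr2]; ring
    rw [h3]
    nlinarith
  have hT : Trig n (fun t => MvPolynomial.eval (fun k => E t k) p) := by
    refine Trig.mvpoly p hp (fun k t => E t k) fun j => ?_
    have h1 : Trig 1 (fun t => (c j + Real.cos t * (x j - c j)) + Real.sin t * (r * u j)) := by
      refine Trig.add (Trig.add ((Trig.const _).mono (by omega)) ?_) ?_
      · exact Trig.cos.mul (Trig.const _)
      · exact Trig.sin.mul (Trig.const _)
    simpa [E] using h1
  have hE0 : E 0 = x := by simp [E]
  have hEd : HasDerivAt E (r • u) 0 := by
    have h1 : HasDerivAt (fun t => (Real.cos t) • (x - c)) _ 0 :=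
      (Real.hasDerivAt_cos 0).smul_const (x - c)
    have h2 : HasDerivAt (fun t => (Real.sin t) • (r • u)) _ 0 :=
      (Real.hasDerivAt_sin 0).smul_const (r • u)
    have := (h1.const_add c).add h2
    refine this.congr_deriv ?_
    simp
  have hF : HasDerivAt (fun t => MvPolynomial.eval (fun k => E t k) p)
      (r * MvPolynomial.eval (fun k => x k) (MvPolynomial.pderiv k p)) 0 := by
    have h1 := hasFDerivAt_eval p (E 0)
    have := h1.comp_hasDerivAt 0 hEd
    refine this.congr_deriv ?_
    rw [hE0]
    simp [hu]
  have := hT.bernstein hn (fun t => hM _ (hE t)) hF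
  rwa [abs_mul, abs_of_nonneg (Real.sqrt_nonneg _)] at this

/-- Markov inequality on the ball. -/
lemma markov_ball {s n : ℕ} (p : MvPolynomial (Fin s) ℝ) (hp : p.totalDegree ≤ n + 1)
    (c : EuclideanSpace ℝ (Fin s)) (h M : ℝ) (hh : 0 ≤ h)
    (hM : ∀ z ∈ Metric.closedBall c h, |MvPolynomial.eval (fun k => z k) p| ≤ M)
    (x : EuclideanSpace ℝ (Fin s)) (hx : x ∈ Metric.closedBall c h) (k : Fin s) :
    h * |MvPolynomial.eval (fun k => x k) (MvPolynomial.pderiv k p)| ≤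
      ((n + 1 : ℕ) : ℝ) ^ 2 * M := by
  have hxn : ‖x - c‖ ≤ h := by simpa [dist_eq_norm] using hx
  set g := MvPolynomial.pderiv k p with hg
  have hgd : g.totalDegree ≤ n := totalDegree_pderiv_le' k p hp
  let E : ℝ → EuclideanSpace ℝ (Fin s) := fun t => c + (Real.cos t) • (x - c)
  have hEn : ∀ t, ‖E t - c‖ ^ 2 = Real.cos t ^ 2 * ‖x - c‖ ^ 2 := by
    intro t
    have : E t - c = (Real.cos t) • (x - c) := by simp [E]
    rw [this, norm_smul, mul_pow, Real.norm_eq_abs, sq_abs]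
  have hE : ∀ t, E t ∈ Metric.closedBall c h := by
    intro t
    rw [Metric.mem_closedBall, dist_eq_norm]
    refine abs_le_of_sq_le_sq' ?_ hh |>.2
    rw [hEn]
    have := Real.cos_sq_le_one t
    nlinarith [norm_nonneg (x - c), sq_nonneg ‖x - c‖]
  have hT0 : Trig n (fun t => MvPolynomial.eval (fun k => E t k) g) := by
    refine Trig.mvpoly g hgd (fun k t => E t k) fun j => ?_
    have h1 : Trig 1 (fun t => (c j + Real.cos t * (x j - c j))) := by
      refine (Trig.add ((Trig.const _).mono (by omega)) ?_)
      exact Trig.cos.mul (Trig.const _)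
    simpa [E] using h1
  have hT : Trig (n + 1) (fun t => h * (MvPolynomial.eval (fun k => E t k) g * Real.sin t)) := by
    simpa using (Trig.const h).mul (hT0.mul Trig.sin)
  have hb : ∀ t, |h * (MvPolynomial.eval (fun k => E t k) g * Real.sin t)| ≤ (n + 1 : ℕ) * M := by
    intro t
    refine le_trans ?_ (bernstein_ball (by omega) p hp c h M hh hM (E t) (hE t) k)
    rw [abs_mul, abs_mul, abs_of_nonneg hh]
    have : h * |Real.sin t| ≤ Real.sqrt (h ^ 2 - ‖E t - c‖ ^ 2) := by
      apply Real.le_sqrt_of_sq_le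
      rw [hEn, mul_pow, sq_abs, Real.sin_sq]
      have : Real.cos t ^ 2 * ‖x - c‖ ^ 2 ≤ Real.cos t ^ 2 * h ^ 2 := by gcongr
      linarith
    calc _ = h * |Real.sin t| * |MvPolynomial.eval (fun k => E t k) g| := by ring
      _ ≤ _ := mul_le_mul_of_nonneg_right this (abs_nonneg _)
  have hE0 : E 0 = x := by simp [E]
  have hEd : HasDerivAt E 0 0 := by
    have h1 : HasDerivAt (fun t => (Real.cos t) • (x - c)) _ 0 :=
      (Real.hasDerivAt_cos 0).smul_const (x - c)
    have := (h1.const_add c)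
    refine this.congr_deriv ?_
    simp
  have hF : HasDerivAt (fun t => h * (MvPolynomial.eval (fun k => E t k) g * Real.sin t))
      (h * MvPolynomial.eval (fun k => x k) g) 0 := by
    have h1 := (hasFDerivAt_eval g (E 0)).comp_hasDerivAt 0 hEd
    have := (h1.mul (Real.hasDerivAt_sin 0)).const_mul h
    refine this.congr_deriv ?_
    simp [hE0]
  have := hT.bernstein (by omega) hb hF
  rw [abs_mul, abs_of_nonneg hh] at this
  calc _ ≤ _ := this
    _ = _ := by ring

/-- Iterated partial derivatives along a word. -/
def pdl (s : ℕ) (L : List (Fin s)) (g : EuclideanSpace ℝ (Fin s) → ℝ) :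
    EuclideanSpace ℝ (Fin s) → ℝ := L.foldr (pd s) g

/-- The word of a multi-index. -/
def wordOf (s : ℕ) (ν : Fin s → ℕ) : List (Fin s) :=
  (List.finRange s).flatMap fun k => List.replicate (ν k) k

lemma Dmulti_eq_pdl (s : ℕ) (ν : Fin s → ℕ) (g : EuclideanSpace ℝ (Fin s) → ℝ) :
    Dmulti s ν g = pdl s (wordOf s ν) g := by
  unfold Dmulti wordOf pdl
  induction List.finRange s with
  | nil => rfl
  | cons k L ih =>
    rw [List.foldr_cons, List.flatMap_cons, List.foldr_append, ih]
    generalize List.foldr (pd s) g _ = a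
    induction ν k with
    | zero => rfl
    | succ n ih2 => rw [Function.iterate_succ_apply', ih2, List.replicate_succ, List.foldr_cons]

lemma wordOf_count (s : ℕ) (ν : Fin s → ℕ) (k : Fin s) : (wordOf s ν).count k = ν k := by
  unfold wordOf
  rw [List.count_flatMap]
  have : (List.count k ∘ fun k => List.replicate (ν k) k) = fun j => if j = k then ν k else 0 := by
    funext j
    simp only [Function.comp, List.count_replicate]
    by_cases h : j = k <;> simp [h]
  rw [this]
  simp [← List.ofFn_eq_map, List.sum_ofFn]

lemma wordOf_length (s : ℕ) (ν : Fin s → ℕ) : (wordOf s ν).length = mdeg s ν := by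
  unfold wordOf mdeg
  simp [List.length_flatMap, ← List.ofFn_eq_map, List.sum_ofFn]

lemma markov_word {s d : ℕ} (p : MvPolynomial (Fin s) ℝ) (hp : p.totalDegree ≤ d)
    (c : EuclideanSpace ℝ (Fin s)) (h M : ℝ) (hh : 0 < h)
    (hM : ∀ z ∈ Metric.closedBall c h, |MvPolynomial.eval (fun k => z k) p| ≤ M)
    (L : List (Fin s)) (hL : L.length ≤ d) :
    ∃ q : MvPolynomial (Fin s) ℝ, q.totalDegree ≤ d - L.length ∧
      pdl s L (fun z => MvPolynomial.eval (fun k => z k) p) =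
        (fun z => MvPolynomial.eval (fun k => z k) q) ∧
      ∀ z ∈ Metric.closedBall c h, h ^ L.length * |MvPolynomial.eval (fun k => z k) q| ≤
        (∏ j ∈ Finset.range L.length, ((d : ℝ) - (j : ℝ)) ^ 2) * M := by
  induction L with
  | nil => exact ⟨p, by simpa using hp, rfl, by simpa using hM⟩
  | cons k L ih =>
    rw [List.length_cons] at hL
    obtain ⟨n, hn⟩ : ∃ n, d - L.length = n + 1 := ⟨d - L.length - 1, by omega⟩
    have hdn : d - (L.length + 1) = n := by omega
    obtain ⟨q, hq, hq1, hq2⟩ := ih (by omega)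
    set P := (∏ j ∈ Finset.range L.length, ((d : ℝ) - (j : ℝ)) ^ 2)
    rw [hn] at hq
    refine ⟨MvPolynomial.pderiv k q, ?_, ?_, fun z hz => ?_⟩
    · rw [List.length_cons, hdn]
      exact totalDegree_pderiv_le' k q hq
    · rw [← pd_eval, ← hq1]; rfl
    · have := markov_ball q hq c h (P * M / h ^ L.length) hh.le
        (fun z hz => by rw [le_div_iff₀' (by positivity)]; exact hq2 z hz) z hz k
      rw [List.length_cons, prod_range_succ]
      have e : ((n + 1 : ℕ) : ℝ) = d - L.length := by
        rw [← hn, Nat.cast_sub (by omega)]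
      rw [e, mul_div_assoc', le_div_iff₀ (by positivity)] at this
      calc _ = _ := by rw [pow_succ]; ring
        _ ≤ _ := this
        _ = _ := by ring

end Markov

section Taylor
open Finset

lemma pd_contDiffOn {s n : ℕ} {U : Set (EuclideanSpace ℝ (Fin s))} (hU : IsOpen U)
    {g : EuclideanSpace ℝ (Fin s) → ℝ} (hg : ContDiffOn ℝ ((n + 1 : ℕ)) g U) (k : Fin s) :
    ContDiffOn ℝ n (pd s k g) U := by
  have h1 : ContDiffOn ℝ n (fderiv ℝ g) U := hg.fderiv_of_isOpen hU (by push_cast; exact le_rfl)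
  exact h1.clm_apply contDiffOn_const

lemma pd_congr {s : ℕ} {U : Set (EuclideanSpace ℝ (Fin s))} (hU : IsOpen U)
    {g g' : EuclideanSpace ℝ (Fin s) → ℝ} (hg : Set.EqOn g g' U) (k : Fin s) :
    Set.EqOn (pd s k g) (pd s k g') U := by
  intro x hx
  unfold pd
  rw [(hg.eventuallyEq_of_mem (hU.mem_nhds hx)).fderiv_eq]

lemma pdl_contDiffOn {s n : ℕ} {U : Set (EuclideanSpace ℝ (Fin s))} (hU : IsOpen U)
    {g : EuclideanSpace ℝ (Fin s) → ℝ} (L : List (Fin s))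
    (hg : ContDiffOn ℝ ((n + L.length : ℕ)) g U) :
    ContDiffOn ℝ n (pdl s L g) U := by
  induction L generalizing n with
  | nil => exact hg
  | cons k L ih =>
    refine pd_contDiffOn hU (ih ?_) k
    rw [List.length_cons] at hg
    rwa [show n + 1 + L.length = n + (L.length + 1) by ring]

lemma pd_comm {s : ℕ} {U : Set (EuclideanSpace ℝ (Fin s))} (hU : IsOpen U)
    {g : EuclideanSpace ℝ (Fin s) → ℝ} (hg : ContDiffOn ℝ ((2 : ℕ)) g U) (k l : Fin s) :
    Set.EqOn (pd s k (pd s l g)) (pd s l (pd s k g)) U := by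
  intro x hx
  have hg' : ContDiffAt ℝ ((2 : ℕ)) g x := hg.contDiffAt (hU.mem_nhds hx)
  have hsym : IsSymmSndFDerivAt ℝ g x := hg'.isSymmSndFDerivAt (by simp)
  have hd : DifferentiableAt ℝ (fderiv ℝ g) x :=
    (hg'.fderiv_right (m := 1) (by norm_num)).differentiableAt (by simp)
  have key : ∀ k l : Fin s, pd s k (pd s l g) x =
      fderiv ℝ (fderiv ℝ g) x (EuclideanSpace.single k 1) (EuclideanSpace.single l 1) := by
    intro k l
    have := hd.hasFDerivAt.clm_apply (hasFDerivAt_const (EuclideanSpace.single l (1 : ℝ)) x)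
    change fderiv ℝ (fun y => fderiv ℝ g y (EuclideanSpace.single l (1 : ℝ))) x _ = _
    rw [this.fderiv]
    simp
  rw [key, key]
  exact hsym _ _

lemma pdl_perm {s : ℕ} {U : Set (EuclideanSpace ℝ (Fin s))} (hU : IsOpen U)
    {g : EuclideanSpace ℝ (Fin s) → ℝ} {L L' : List (Fin s)} (h : L.Perm L')
    (hg : ContDiffOn ℝ ((L.length : ℕ)) g U) :
    Set.EqOn (pdl s L g) (pdl s L' g) U := by
  induction h with
  | nil => exact fun x _ => rfl
  | cons k h ih =>
    exact pd_congr hU (ih (hg.of_le (by exact_mod_cast (by simp)))) k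
  | swap k l L =>
    refine pd_comm hU (g := pdl s L g) (pdl_contDiffOn hU L ?_) l k
    rwa [show 2 + L.length = (l :: k :: L).length by simp; ring]
  | trans h1 h2 ih1 ih2 =>
    exact (ih1 hg).trans (ih2 (by rwa [← h1.length_eq]))

lemma pdl_sub {s : ℕ} {U : Set (EuclideanSpace ℝ (Fin s))} (hU : IsOpen U)
    {f g : EuclideanSpace ℝ (Fin s) → ℝ} (L : List (Fin s))
    (hf : ContDiffOn ℝ ((L.length : ℕ)) f U) (hg : ContDiffOn ℝ ((L.length : ℕ)) g U) :
    Set.EqOn (pdl s L (fun z => f z - g z)) (fun z => pdl s L f z - pdl s L g z) U := by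
  induction L with
  | nil => exact fun x _ => rfl
  | cons k L ih =>
    have ih' := ih (hf.of_le (by exact_mod_cast (by simp))) (hg.of_le (by exact_mod_cast (by simp)))
    refine (pd_congr hU ih' k).trans fun x hx => ?_
    have hx' := hU.mem_nhds hx
    rw [List.length_cons, add_comm] at hf hg
    have h1 := ((pdl_contDiffOn hU L hf).contDiffAt hx').differentiableAt (by simp)
    have h2 := ((pdl_contDiffOn hU L hg).contDiffAt hx').differentiableAt (by simp)
    change fderiv ℝ (fun z => pdl s L f z - pdl s L g z) x _ = _
    rw [fderiv_fun_sub h1 h2]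
    rfl

lemma pd_Dmulti {s : ℕ} {U : Set (EuclideanSpace ℝ (Fin s))} (hU : IsOpen U)
    {g : EuclideanSpace ℝ (Fin s) → ℝ} (ν : Fin s → ℕ) (k : Fin s)
    (hg : ContDiffOn ℝ ((mdeg s ν + 1 : ℕ)) g U) :
    Set.EqOn (pd s k (Dmulti s ν g)) (Dmulti s (ν + Pi.single k 1) g) U := by
  rw [Dmulti_eq_pdl, Dmulti_eq_pdl]
  refine pdl_perm hU (L := k :: wordOf s ν) ?_ (by rwa [List.length_cons, wordOf_length])
  rw [List.perm_iff_count]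
  intro j
  rw [List.count_cons, wordOf_count, wordOf_count, Pi.add_apply, Pi.single_apply]
  by_cases h : k = j
  · simp [h]
  · simp [h, Ne.symm h]

lemma mdeg_add_single {s : ℕ} (ν : Fin s → ℕ) (k : Fin s) :
    mdeg s (ν + Pi.single k 1) = mdeg s ν + 1 := by
  simp [mdeg, sum_add_distrib]

lemma mpow_contDiff {s : ℕ} (c : EuclideanSpace ℝ (Fin s)) (β : Fin s → ℕ) :
    ContDiff ℝ ⊤ (fun z : EuclideanSpace ℝ (Fin s) => mpow s (z - c) β) := by
  unfold mpow
  refine contDiff_prod fun k _ => ?_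
  have : ContDiff ℝ ⊤ (fun z : EuclideanSpace ℝ (Fin s) => (z - c) k) :=
    (EuclideanSpace.proj k : EuclideanSpace ℝ (Fin s) →L[ℝ] ℝ).contDiff.comp
      (contDiff_id.sub contDiff_const)
  exact this.pow _

lemma pd_mpow {s : ℕ} (c : EuclideanSpace ℝ (Fin s)) (β : Fin s → ℕ) (k : Fin s)
    (z : EuclideanSpace ℝ (Fin s)) :
    fderiv ℝ (fun z : EuclideanSpace ℝ (Fin s) => mpow s (z - c) β) z (EuclideanSpace.single k 1) =
      β k * mpow s (z - c) (fun j => β j - if j = k then 1 else 0) := by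
  have hd : DifferentiableAt ℝ (fun z : EuclideanSpace ℝ (Fin s) => mpow s (z - c) β) z :=
    (mpow_contDiff c β).differentiable (by simp) z
  rw [← hd.lineDeriv_eq_fderiv]
  have h2 : HasLineDerivAt ℝ (fun z : EuclideanSpace ℝ (Fin s) => mpow s (z - c) β)
      (β k * mpow s (z - c) (fun j => β j - if j = k then 1 else 0)) z
      (EuclideanSpace.single k 1) := by
    unfold HasLineDerivAt
    have e : (fun t : ℝ => mpow s (z + t • EuclideanSpace.single k 1 - c) β) =
        fun t => (z k - c k + t) ^ β k * ∏ j ∈ univ.erase k, (z j - c j) ^ β j := by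
      funext t
      unfold mpow
      rw [← mul_prod_erase _ _ (mem_univ k)]
      congr 1
      · simp; ring
      · refine prod_congr rfl fun j hj => ?_
        simp [ne_of_mem_erase hj]
    rw [e]
    have h3 : HasDerivAt (fun t : ℝ => (z k - c k + t) ^ β k) _ 0 :=
      ((hasDerivAt_id (0 : ℝ)).const_add (z k - c k)).pow (β k)
    refine (h3.mul_const _).congr_deriv ?_
    unfold mpow
    rw [← mul_prod_erase univ _ (mem_univ k)]
    have : ∏ j ∈ univ.erase k, (z - c) j ^ (β j - if j = k then 1 else 0) =
        ∏ j ∈ univ.erase k, (z j - c j) ^ β j := by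
      refine prod_congr rfl fun j hj => ?_
      simp [ne_of_mem_erase hj]
    rw [this]
    simp
    ring
  exact h2.lineDeriv

lemma pdl_poly {s : ℕ} {ι : Type*} [Fintype ι] (a : ι → ℝ) (γ : ι → Fin s → ℕ)
    (c : EuclideanSpace ℝ (Fin s)) (L : List (Fin s)) :
    pdl s L (fun z => ∑ b, a b * mpow s (z - c) (γ b)) = fun z => ∑ b,
      a b * (∏ k, ((γ b k).descFactorial (L.count k) : ℝ)) *
        mpow s (z - c) (fun k => γ b k - L.count k) := by
  induction L with
  | nil => simp [pdl]
  | cons k L ih =>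
    change pd s k (pdl s L _) = _
    rw [ih]
    funext z
    have hd : ∀ b ∈ univ, DifferentiableAt ℝ (fun z : EuclideanSpace ℝ (Fin s) =>
        a b * (∏ k, ((γ b k).descFactorial (L.count k) : ℝ)) *
        mpow s (z - c) (fun k => γ b k - L.count k)) z := fun b _ =>
      ((mpow_contDiff c _).differentiable (by simp) z).const_mul _
    unfold pd
    rw [fderiv_fun_sum hd, ContinuousLinearMap.sum_apply]
    refine sum_congr rfl fun b _ => ?_
    rw [fderiv_const_mul ((mpow_contDiff c _).differentiable (by simp) z),
      ContinuousLinearMap.smul_apply, pd_mpow, smul_eq_mul]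
    have e1 : (fun j => γ b j - L.count j - if j = k then 1 else 0) =
        fun j => γ b j - (k :: L).count j := by
      funext j
      rw [List.count_cons]
      by_cases h : j = k
      · simp [h]; omega
      · simp [h, Ne.symm h]
    have e2 : (∏ j, ((γ b j).descFactorial ((k :: L).count j) : ℝ)) =
        (∏ j, ((γ b j).descFactorial (L.count j) : ℝ)) * ((γ b k - L.count k : ℕ) : ℝ) := by
      rw [← mul_prod_erase univ _ (mem_univ k), ← mul_prod_erase univ (fun j =>
        ((γ b j).descFactorial (L.count j) : ℝ)) (mem_univ k)]
      have : ∏ j ∈ univ.erase k, ((γ b j).descFactorial ((k :: L).count j) : ℝ) =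
          ∏ j ∈ univ.erase k, ((γ b j).descFactorial (L.count j) : ℝ) := by
        refine prod_congr rfl fun j hj => ?_
        rw [List.count_cons_of_ne (ne_of_mem_erase hj).symm]
      rw [this, List.count_cons_self, Nat.descFactorial_succ]
      push_cast
      ring
    rw [e1, e2]
    ring

lemma taylorP_eq (s d : ℕ) (f : EuclideanSpace ℝ (Fin s) → ℝ) (c : EuclideanSpace ℝ (Fin s)) :
    taylorP s d f c = fun z => ∑ β : Fin s → Fin (d + 1),
      (if mdeg s (fun k => (β k : ℕ)) ≤ d then
        Dmulti s (fun k => (β k : ℕ)) f c / (mfact s (fun k => (β k : ℕ)) : ℝ) else 0) *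
      mpow s (z - c) (fun k => (β k : ℕ)) := by
  funext z
  unfold taylorP
  refine sum_congr rfl fun β _ => ?_
  split_ifs <;> ring

lemma taylorP_contDiff (s d : ℕ) (f : EuclideanSpace ℝ (Fin s) → ℝ)
    (c : EuclideanSpace ℝ (Fin s)) : ContDiff ℝ ⊤ (taylorP s d f c) := by
  rw [taylorP_eq]
  exact ContDiff.sum fun b _ => contDiff_const.mul (mpow_contDiff c _)

/-- Derivatives of the Taylor polynomial: at the centre, or of top order. -/
lemma Dmulti_taylorP {s d : ℕ} (f : EuclideanSpace ℝ (Fin s) → ℝ) (c z : EuclideanSpace ℝ (Fin s))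
    (ν : Fin s → ℕ) (hν : mdeg s ν ≤ d) (hz : z = c ∨ mdeg s ν = d) :
    Dmulti s ν (taylorP s d f c) z = Dmulti s ν f c := by
  have hle : ∀ k, ν k ≤ d := fun k =>
    (single_le_sum (f := ν) (fun _ _ => Nat.zero_le _) (mem_univ k)).trans hν
  rw [Dmulti_eq_pdl s ν (taylorP s d f c), taylorP_eq, pdl_poly]
  simp only [wordOf_count]
  let b0 : Fin s → Fin (d + 1) := fun k => ⟨ν k, Nat.lt_succ_of_le (hle k)⟩
  rw [sum_eq_single b0]
  · have : (fun k => ((b0 k : Fin (d + 1)) : ℕ)) = ν := rfl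
    simp only [this, if_pos hν]
    have h1 : ∀ k, ((b0 k : Fin (d + 1)) : ℕ) = ν k := fun k => rfl
    have hne : (mfact s ν : ℝ) ≠ 0 := by
      unfold mfact
      exact_mod_cast prod_ne_zero_iff.2 fun k _ => Nat.factorial_ne_zero _
    have h2 : ∏ k, (((b0 k : Fin (d + 1)) : ℕ).descFactorial (ν k) : ℝ) = mfact s ν := by
      unfold mfact
      push_cast
      refine prod_congr rfl fun k _ => ?_
      rw [h1, Nat.descFactorial_self]
    rw [h2]
    simp only [h1]
    simp [mpow]
    field_simp
  · intro b _ hb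
    by_cases hb1 : mdeg s (fun k => (b k : ℕ)) ≤ d
    swap
    · simp [hb1]
    by_cases hb2 : ∀ k, ν k ≤ b k
    · have hlt : ∃ k, ν k < b k := by
        by_contra hcon
        push Not at hcon
        exact hb (funext fun k => Fin.ext (le_antisymm (hcon k) (hb2 k)))
      rcases hz with rfl | hz
      · obtain ⟨k, hk⟩ := hlt
        have : mpow s (z - z) (fun k => (b k : ℕ) - ν k) = 0 := by
          unfold mpow
          refine prod_eq_zero (mem_univ k) ?_
          simp
          omega
        rw [this, mul_zero]
      · exfalso
        have : mdeg s ν < mdeg s (fun k => (b k : ℕ)) := by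
          obtain ⟨k, hk⟩ := hlt
          exact sum_lt_sum (fun k _ => hb2 k) ⟨k, mem_univ k, hk⟩
        omega
    · push Not at hb2
      obtain ⟨k, hk⟩ := hb2
      have : ∏ k, (((b k : Fin (d + 1)) : ℕ).descFactorial (ν k) : ℝ) = 0 := by
        refine prod_eq_zero (mem_univ k) ?_
        exact_mod_cast Nat.descFactorial_of_lt hk
      rw [this]; simp
  · simp

/-- Lipschitz bound through the seminorm. -/
lemma semi_bound {s d : ℕ} {f : EuclideanSpace ℝ (Fin s) → ℝ}
    {Ω K : Set (EuclideanSpace ℝ (Fin s))} (hf : Cd1 s d f Ω) (hK : K ⊆ Ω)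
    (ν : Fin s → ℕ) (hν : mdeg s ν = d) (u v : EuclideanSpace ℝ (Fin s)) (hu : u ∈ K)
    (hv : v ∈ K) : |Dmulti s ν f u - Dmulti s ν f v| ≤ semi s d f K * ‖u - v‖ := by
  by_cases huv : u = v
  · simp [huv]
  have hpos : 0 < ‖u - v‖ := norm_pos_iff.2 (sub_ne_zero.2 huv)
  rw [← div_le_iff₀ hpos]
  refine le_csSup ?_ ⟨ν, u, v, hν, hu, hv, huv, rfl⟩
  choose! C hC using hf.2
  have hfin : {ν : Fin s → ℕ | mdeg s ν = d}.Finite := by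
    refine (Set.finite_Iic (fun _ : Fin s => d)).subset fun ν hν k => ?_
    rw [← show mdeg s ν = d from hν]
    exact single_le_sum (f := ν) (fun _ _ => Nat.zero_le _) (mem_univ k)
  obtain ⟨B, hB⟩ := (hfin.image fun ν => (C ν : ℝ)).bddAbove
  refine ⟨B, ?_⟩
  rintro r ⟨μ, a, b, hμ, ha, hb, hab, rfl⟩
  have hpos : 0 < ‖a - b‖ := norm_pos_iff.2 (sub_ne_zero.2 hab)
  rw [div_le_iff₀ hpos]
  have h1 := (hC μ hμ).dist_le_mul a (hK ha) b (hK hb)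
  rw [Real.dist_eq, dist_eq_norm] at h1
  exact h1.trans (mul_le_mul_of_nonneg_right (hB ⟨μ, hμ, rfl⟩) hpos.le)

lemma semi_nonneg (s d : ℕ) (f : EuclideanSpace ℝ (Fin s) → ℝ)
    (K : Set (EuclideanSpace ℝ (Fin s))) : 0 ≤ semi s d f K := by
  refine Real.sSup_nonneg ?_
  rintro r ⟨μ, a, b, hμ, ha, hb, hab, rfl⟩
  positivity

lemma fderiv_eq_sum_pd {s : ℕ} (g : EuclideanSpace ℝ (Fin s) → ℝ) (z v : EuclideanSpace ℝ (Fin s)) :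
    fderiv ℝ g z v = ∑ k, v k * pd s k g z := by
  have : v = ∑ k, v k • EuclideanSpace.single k (1 : ℝ) := by
    have := (EuclideanSpace.basisFun (Fin s) ℝ).sum_repr v
    simpa using this.symm
  conv_lhs => rw [this]
  simp [pd]

/-- Main induction for the Taylor remainder. -/
lemma taylor_induct {s d : ℕ} {g : EuclideanSpace ℝ (Fin s) → ℝ}
    {c : EuclideanSpace ℝ (Fin s)} {h A : ℝ} (hA : 0 ≤ A)
    (hg : ContDiffOn ℝ d g (Metric.ball c h))
    (h0 : ∀ ν : Fin s → ℕ, mdeg s ν ≤ d → Dmulti s ν g c = 0)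
    (htop : ∀ ν : Fin s → ℕ, mdeg s ν = d → ∀ z ∈ Metric.ball c h,
      |Dmulti s ν g z| ≤ A * ‖z - c‖) (m : ℕ) :
    ∀ ν : Fin s → ℕ, mdeg s ν + m = d → ∀ z ∈ Metric.ball c h,
      |Dmulti s ν g z| ≤ A * s ^ m * ‖z - c‖ ^ (m + 1) / (m + 1).factorial := by
  have hU : IsOpen (Metric.ball c h) := Metric.isOpen_ball
  induction m with
  | zero => intro ν hν z hz; simpa using htop ν hν z hz
  | succ m ih =>
    intro ν hν z hz
    set N := ‖z - c‖ with hN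
    have hNh : N < h := by simpa [dist_eq_norm] using hz
    have hD : ContDiffOn ℝ ((1 : ℕ)) (Dmulti s ν g) (Metric.ball c h) := by
      rw [Dmulti_eq_pdl]
      refine pdl_contDiffOn hU _ (hg.of_le ?_)
      rw [wordOf_length]
      exact_mod_cast (by omega)
    have hseg : ∀ t ∈ Set.Icc (0 : ℝ) 1, c + t • (z - c) ∈ Metric.ball c h := by
      intro t ht
      rw [Metric.mem_ball, dist_eq_norm, add_sub_cancel_left, norm_smul, Real.norm_of_nonneg ht.1]
      exact (mul_le_of_le_one_left (norm_nonneg _) ht.2).trans_lt hNh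
    let ψ : ℝ → ℝ := fun t => Dmulti s ν g (c + t • (z - c))
    have hψ : ∀ t ∈ Set.Icc (0 : ℝ) 1, HasDerivAt ψ
        (∑ k, (z - c) k * pd s k (Dmulti s ν g) (c + t • (z - c))) t := by
      intro t ht
      rw [← fderiv_eq_sum_pd]
      have h1 := ((hD.contDiffAt (hU.mem_nhds (hseg t ht))).differentiableAt (by simp)).hasFDerivAt
      have h2 : HasDerivAt (fun t : ℝ => c + t • (z - c)) (z - c) t := by
        simpa using ((hasDerivAt_id t).smul_const (z - c)).const_add c
      exact h1.comp_hasDerivAt t h2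
    set Q : ℝ := A * s ^ (m + 1) * N ^ (m + 2) with hQ
    have hB : ∀ t : ℝ, HasDerivAt (fun t : ℝ => Q / (m + 2).factorial * t ^ (m + 2))
        (Q / (m + 1).factorial * t ^ (m + 1)) t := by
      intro t
      have h1 := (hasDerivAt_pow (m + 2) t).const_mul (Q / (m + 2).factorial)
      refine h1.congr_deriv ?_
      rw [Nat.factorial_succ (m + 1)]
      have : ((m + 1).factorial : ℝ) ≠ 0 := by exact_mod_cast Nat.factorial_ne_zero _
      have h3 : ((m : ℝ) + 1 + 1) ≠ 0 := by positivity
      simp only [Nat.add_sub_cancel, show m + 2 - 1 = m + 1 by omega]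
      push_cast
      field_simp
      ring
    have key := image_norm_le_of_norm_deriv_right_le_deriv_boundary (a := 0) (b := 1) (f := ψ)
      (fun t ht => (hψ t ht).continuousAt.continuousWithinAt)
      (fun t ht => (hψ t (Set.Ico_subset_Icc_self ht)).hasDerivWithinAt)
      (B := fun t : ℝ => Q / (m + 2).factorial * t ^ (m + 2))
      (by simp [ψ, h0 ν (by omega)]) hB ?_ (Set.right_mem_Icc.2 zero_le_one)
    · simp only [ψ, one_smul, add_sub_cancel, one_pow, mul_one, Real.norm_eq_abs] at key
      exact key
    · intro t ht
      have ht' := Set.Ico_subset_Icc_self ht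
      rw [Real.norm_eq_abs]
      refine (abs_sum_le_sum_abs _ _).trans ?_
      have hterm : ∀ k ∈ (univ : Finset (Fin s)),
          |(z - c) k * pd s k (Dmulti s ν g) (c + t • (z - c))| ≤
          N * (A * s ^ m * (t * N) ^ (m + 1) / (m + 1).factorial) := by
        intro k _
        rw [abs_mul]
        have h1 : |(z - c) k| ≤ N := by
          rw [← Real.norm_eq_abs]; exact PiLp.norm_apply_le _ k
        have h2 : pd s k (Dmulti s ν g) (c + t • (z - c)) =
            Dmulti s (ν + Pi.single k 1) g (c + t • (z - c)) :=
          pd_Dmulti hU ν k (hg.of_le (by exact_mod_cast (by omega))) (hseg t ht')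
        have h3 := ih (ν + Pi.single k 1) (by rw [mdeg_add_single]; omega) _ (hseg t ht')
        rw [add_sub_cancel_left, norm_smul, Real.norm_of_nonneg ht'.1] at h3
        rw [h2]
        exact mul_le_mul h1 h3 (abs_nonneg _) (norm_nonneg _)
      refine (sum_le_card_nsmul _ _ _ hterm).trans (le_of_eq ?_)
      simp only [card_univ, Fintype.card_fin, nsmul_eq_mul, hQ]
      ring

lemma taylorR_bound {s d : ℕ} (hd : 1 ≤ d) {f : EuclideanSpace ℝ (Fin s) → ℝ}
    {Ω : Set (EuclideanSpace ℝ (Fin s))} (hf : Cd1 s d f Ω) {c : EuclideanSpace ℝ (Fin s)}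
    {h : ℝ} (hh : 0 < h) (hball : Metric.closedBall c h ⊆ Ω) (z : EuclideanSpace ℝ (Fin s))
    (hz : z ∈ Metric.closedBall c h) :
    |taylorR s d f c z| ≤ kconst s d * semi s d f (Metric.closedBall c h) * h ^ (d + 1) := by
  set A := semi s d f (Metric.closedBall c h) with hA
  have hA0 : 0 ≤ A := semi_nonneg _ _ _ _
  have hU : IsOpen (Metric.ball c h) := Metric.isOpen_ball
  have hsub : Metric.ball c h ⊆ Ω := Metric.ball_subset_closedBall.trans hball
  have hfU : ContDiffOn ℝ d f (Metric.ball c h) := hf.1.mono hsub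
  have hTU : ∀ (n : ℕ) (V : Set (EuclideanSpace ℝ (Fin s))), ContDiffOn ℝ n (taylorP s d f c) V :=
    fun n V => ((taylorP_contDiff s d f c).of_le le_top).contDiffOn
  have hcU : c ∈ Metric.ball c h := Metric.mem_ball_self hh
  have hD : ∀ ν : Fin s → ℕ, mdeg s ν ≤ d → ∀ z ∈ Metric.ball c h,
      Dmulti s ν (taylorR s d f c) z =
        Dmulti s ν f z - Dmulti s ν (taylorP s d f c) z := by
    intro ν hν z hz
    rw [Dmulti_eq_pdl, Dmulti_eq_pdl, Dmulti_eq_pdl]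
    exact pdl_sub hU _ (hfU.of_le (by rw [wordOf_length]; exact_mod_cast hν)) (hTU _ _) hz
  have main := taylor_induct (g := taylorR s d f c) (c := c) (h := h) (A := A) hA0
    (hfU.sub (hTU d _))
    (fun ν hν => by rw [hD ν hν c hcU, Dmulti_taylorP f c c ν hν (Or.inl rfl), sub_self])
    (fun ν hν z hz => by
      rw [hD ν hν.le z hz, Dmulti_taylorP f c z ν hν.le (Or.inr hν)]
      exact semi_bound hf hball ν hν z c (Metric.ball_subset_closedBall hz)
        (Metric.mem_closedBall_self hh.le)) d 0 (by simp [mdeg])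
  have hzero : ∀ g, Dmulti s 0 g = g := by
    intro g
    rw [Dmulti_eq_pdl]
    have : wordOf s 0 = [] := by
      rw [← List.length_eq_zero_iff, wordOf_length]; simp [mdeg]
    rw [this]; rfl
  rw [hzero] at main
  have hk : kconst s d = (s : ℝ) ^ d / ((d - 1).factorial : ℝ) := by
    unfold kconst; rw [if_neg (by omega)]
  have main2 : ∀ z ∈ Metric.ball c h, |taylorR s d f c z| ≤ kconst s d * A * h ^ (d + 1) := by
    intro z hz
    refine (main z hz).trans ?_
    have hN : ‖z - c‖ ≤ h := by
      have : ‖z - c‖ < h := by simpa [dist_eq_norm] using hz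
      exact this.le
    have hfac : ((d - 1).factorial : ℝ) ≤ (d + 1).factorial := by
      exact_mod_cast Nat.factorial_le (by omega)
    have hfp : (0 : ℝ) < (d - 1).factorial := by exact_mod_cast Nat.factorial_pos _
    calc A * s ^ d * ‖z - c‖ ^ (d + 1) / (d + 1).factorial
        ≤ A * s ^ d * h ^ (d + 1) / (d - 1).factorial := by gcongr
      _ = _ := by rw [hk]; ring
  have hcl : z ∈ closure (Metric.ball c h) := by rwa [closure_ball c hh.ne']
  have hcont : ContinuousWithinAt (taylorR s d f c) (Metric.ball c h) z := by
    have h1 : ContinuousWithinAt f (Metric.ball c h) z :=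
      (hf.1.continuousOn z (hball hz)).mono hsub
    exact h1.sub (taylorP_contDiff s d f c).continuous.continuousWithinAt
  exact ContinuousWithinAt.closure_le hcl hcont.abs continuousWithinAt_const main2

end Taylor

theorem stmt6
    (s d m : ℕ) (hs : 1 ≤ s) (hd : 1 ≤ d) (hm : m = Nat.choose (d + s) s)
    (x : Fin m → EuclideanSpace ℝ (Fin s))
    (huni : Unisolvent s d m x)
    (ℓ : Fin m → MvPolynomial (Fin s) ℝ) (hℓ : IsLagrangeBasis s d m x ℓ)
    (Ω : Set (EuclideanSpace ℝ (Fin s)))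
    (hΩconv : Convex ℝ Ω) (hΩcomp : IsCompact Ω) (hΩint : (interior Ω).Nonempty)
    (hxΩ : ∀ i, x i ∈ Ω)
    (xbar : EuclideanSpace ℝ (Fin s))
    (f : EuclideanSpace ℝ (Fin s) → ℝ) (hf : Cd1 s d f Ω)
    (h : ℝ) (hh : IsGreatest (Set.range fun i => ‖x i - xbar‖) h)
    (hball : Metric.closedBall xbar h ⊆ Ω)
    (K : Set (EuclideanSpace ℝ (Fin s))) (hK : K = Metric.closedBall xbar h)
    (xx : EuclideanSpace ℝ (Fin s)) (hxx : xx ∈ Metric.closedBall xbar h)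
    (ν : Fin s → ℕ) (hν : mdeg s ν ≤ d) :
    |Dmulti s ν (fun z => ∑ i, MvPolynomial.eval (fun k => z k) (ℓ i) *
        taylorR s d f xbar (x i)) xx| ≤
      kconst s d * Mconst d ν * semi s d f K * h ^ (d - mdeg s ν + 1) *
        lebesgue s m ℓ Ω := by
  have hm2 : 2 ≤ m := by
    obtain ⟨a, rfl⟩ : ∃ a, s = a + 1 := ⟨s - 1, by omega⟩
    obtain ⟨b, rfl⟩ : ∃ b, d = b + 1 := ⟨d - 1, by omega⟩
    rw [hm, show b + 1 + (a + 1) = (b + a + 1) + 1 by ring, Nat.choose_succ_succ]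
    have h1 : 0 < (b + a + 1).choose a := Nat.choose_pos (by omega)
    have h2 : 0 < (b + a + 1).choose (a + 1) := Nat.choose_pos (by omega)
    simp only [Nat.succ_eq_add_one]
    omega
  have hxh : ∀ i, ‖x i - xbar‖ ≤ h := fun i => hh.2 ⟨i, rfl⟩
  have hpos : 0 < h := by
    by_contra hneg
    have hx0 : ∀ i, x i = xbar := fun i => by
      have : ‖x i - xbar‖ ≤ 0 := (hxh i).trans (not_lt.1 hneg)
      exact sub_eq_zero.1 (norm_le_zero_iff.1 this)
    have := huni.1 ((hx0 ⟨0, by omega⟩).trans (hx0 ⟨1, by omega⟩).symm)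
    simp at this
  subst hK
  set R : Fin m → ℝ := fun i => taylorR s d f xbar (x i) with hR
  set B := kconst s d * semi s d f (Metric.closedBall xbar h) * h ^ (d + 1) with hB
  have hRb : ∀ i, |R i| ≤ B := fun i =>
    taylorR_bound hd hf hpos hball (x i) (by simpa [dist_eq_norm] using hxh i)
  have hB0 : 0 ≤ B := (abs_nonneg _).trans (hRb ⟨0, by omega⟩)
  let q : MvPolynomial (Fin s) ℝ := ∑ i, ℓ i * MvPolynomial.C (R i)
  have hq : q.totalDegree ≤ d := by
    refine MvPolynomial.totalDegree_finsetSum_le fun i _ => ?_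
    refine (MvPolynomial.totalDegree_mul _ _).trans ?_
    rw [MvPolynomial.totalDegree_C, add_zero]
    exact hℓ.1 i
  have hqe : (fun z : EuclideanSpace ℝ (Fin s) => ∑ i, MvPolynomial.eval (fun k => z k) (ℓ i) *
      taylorR s d f xbar (x i)) = fun z => MvPolynomial.eval (fun k => z k) q := by
    funext z
    simp [q, hR]
  have hcont : Continuous (fun z : EuclideanSpace ℝ (Fin s) =>
      ∑ i, |MvPolynomial.eval (fun k => z k) (ℓ i)|) := by
    refine continuous_finsetSum _ fun i _ => Continuous.abs ?_
    exact continuous_iff_continuousAt.2 fun z => (hasFDerivAt_eval (ℓ i) z).continuousAt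
  have hleb : ∀ z ∈ Ω, ∑ i, |MvPolynomial.eval (fun k => z k) (ℓ i)| ≤ lebesgue s m ℓ Ω :=
    fun z hz => le_csSup (hΩcomp.image hcont).bddAbove ⟨z, hz, rfl⟩
  have hqM : ∀ z ∈ Metric.closedBall xbar h, |MvPolynomial.eval (fun k => z k) q| ≤
      B * lebesgue s m ℓ Ω := by
    intro z hz
    rw [← congrFun hqe z]
    refine (Finset.abs_sum_le_sum_abs _ _).trans ?_
    refine le_trans ?_ (mul_le_mul_of_nonneg_left (hleb z (hball hz)) hB0)
    rw [Finset.mul_sum]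
    refine Finset.sum_le_sum fun i _ => ?_
    rw [abs_mul, mul_comm]
    exact mul_le_mul_of_nonneg_right (hRb i) (abs_nonneg _)
  obtain ⟨p, -, hp1, hp2⟩ := markov_word q hq xbar h _ hpos hqM (wordOf s ν)
    (by rwa [wordOf_length])
  rw [hqe, Dmulti_eq_pdl, hp1]
  have key := hp2 xx hxx
  rw [wordOf_length] at key
  have hM : Mconst d ν = ∏ j ∈ Finset.range (mdeg s ν), ((d : ℝ) - (j : ℝ)) ^ 2 := rfl
  rw [← hM] at key
  refine le_of_mul_le_mul_left ?_ (pow_pos hpos (mdeg s ν))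
  refine key.trans (le_of_eq ?_)
  have : h ^ (d + 1) = h ^ mdeg s ν * h ^ (d - mdeg s ν + 1) := by
    rw [← pow_add]; congr 1; omega
  rw [hB, this]
  ring

end
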